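/- Let 0 < α < 1, p ≥ 0, b ∈ ℝ, and let y be four times continuously differentiable on [b, X] with y(b) = y'(b) = y''(b) = 0 (y extended by zero to the left of b). Then for every x with b < x < X there exist constants C > 0 and h₀ > 0 such that for all 0 < h < h₀ with x + p·h ≤ X, |h^(−α)·Δ_{h,p}^α y(x) − y^(α)(x + (p − α/2)·h)| ≤ C·h². -/

import Mathlib

/-- The Caputo fractional derivative of order `α` with lower limit `b`. -/
noncomputable def caputo (α b : ℝ) (y : ℝ → ℝ) (x : ℝ) : ℝ :=
  (1 / Real.Gamma (1 - α)) * ∫ ξ in b..x, deriv y ξ * (x - ξ) ^ (-α)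

/-- The Grünwald weights `w_n^(α) = (-1)^n * C(α, n)`. -/
noncomputable def grunwaldW (α : ℝ) (n : ℕ) : ℝ :=
  (-1) ^ n * (Real.Gamma (α + 1) / (Real.Gamma ((n : ℝ) + 1) * Real.Gamma (α - (n : ℝ) + 1)))

/-- The shifted Grünwald difference operator with shift `p`, step `h`, lower limit `b`. -/
noncomputable def shiftedGrunwald (α b p h : ℝ) (y : ℝ → ℝ) (x : ℝ) : ℝ :=
  ∑ n ∈ Finset.range (⌊(x - b) / h⌋₊ + 1), grunwaldW α n * y (x - ((n : ℝ) - p) * h)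

/-- The partial sums of the Grünwald weights, in closed form. -/
noncomputable def grunwaldS (α : ℝ) (n : ℕ) : ℝ :=
  Real.Gamma (n + 1 - α) / (Real.Gamma (1 - α) * Real.Gamma (n + 1))

lemma grunwaldS_zero {α : ℝ} (hα1 : α < 1) : grunwaldS α 0 = 1 := by
  have : Real.Gamma (1 - α) ≠ 0 := (Real.Gamma_pos_of_pos (by linarith)).ne'
  simp [grunwaldS, this]

lemma grunwaldS_succ {α : ℝ} (hα1 : α < 1) (n : ℕ) :
    grunwaldS α (n + 1) = (n + 1 - α) / (n + 1) * grunwaldS α n := by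
  have hn : (0 : ℝ) < n + 1 := by positivity
  have h3 : (0 : ℝ) < n + 1 - α := by
    linarith
  unfold grunwaldS
  push_cast
  rw [Real.Gamma_add_one hn.ne', show (n : ℝ) + 1 + 1 - α = (n + 1 - α) + 1 by ring,
    Real.Gamma_add_one h3.ne']
  field_simp

lemma grunwaldS_pos {α : ℝ} (hα1 : α < 1) (n : ℕ) : 0 < grunwaldS α n := by
  have h3 := Real.Gamma_pos_of_pos (show 0 < (n : ℝ) + 1 - α by linarith)
  unfold grunwaldS
  positivity

lemma sub_natCast_ne_zero {α : ℝ} (hα0 : 0 < α) (hα1 : α < 1) (n : ℕ) : α - n ≠ 0 := by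
  rcases n.eq_zero_or_pos with rfl | hn
  · simpa using hα0.ne'
  · have : (1 : ℝ) ≤ n := by exact_mod_cast hn
    linarith

lemma grunwaldW_zero {α : ℝ} (hα0 : 0 < α) : grunwaldW α 0 = 1 := by
  have : Real.Gamma (α + 1) ≠ 0 := (Real.Gamma_pos_of_pos (by linarith)).ne'
  simp [grunwaldW, this]

lemma grunwaldW_succ {α : ℝ} (hα0 : 0 < α) (hα1 : α < 1) (n : ℕ) :
    grunwaldW α (n + 1) = (n - α) / (n + 1) * grunwaldW α n := by
  have hn : (0 : ℝ) < n + 1 := by positivity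
  have h0 := sub_natCast_ne_zero hα0 hα1 n
  unfold grunwaldW
  push_cast
  rw [Real.Gamma_add_one hn.ne', show α - ((n : ℝ) + 1) + 1 = α - n by ring,
    Real.Gamma_add_one h0, pow_succ]
  field_simp
  ring

lemma grunwaldW_eq {α : ℝ} (hα0 : 0 < α) (hα1 : α < 1) (n : ℕ) :
    (n - α) * grunwaldW α n = -α * grunwaldS α n := by
  induction n with
  | zero => simp [grunwaldW_zero hα0, grunwaldS_zero hα1]
  | succ n ih =>
    rw [grunwaldW_succ hα0 hα1, grunwaldS_succ hα1]
    push_cast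
    linear_combination ((n + 1 - α) / (n + 1)) * ih

lemma grunwaldW_succ_eq {α : ℝ} (hα0 : 0 < α) (hα1 : α < 1) (n : ℕ) :
    grunwaldW α (n + 1) = -α / (n + 1) * grunwaldS α n := by
  rw [grunwaldW_succ hα0 hα1]
  linear_combination (1 / ((n : ℝ) + 1)) * grunwaldW_eq hα0 hα1 n

lemma sum_grunwaldW {α : ℝ} (hα0 : 0 < α) (hα1 : α < 1) (M : ℕ) :
    ∑ n ∈ Finset.range (M + 1), grunwaldW α n = grunwaldS α M := by
  induction M with
  | zero => simp [grunwaldW_zero hα0, grunwaldS_zero hα1]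
  | succ M ih =>
    rw [Finset.sum_range_succ, ih, grunwaldW_succ_eq hα0 hα1, grunwaldS_succ hα1]
    field_simp
    ring

lemma sum_grunwaldW_mul {α : ℝ} (hα0 : 0 < α) (hα1 : α < 1) (M : ℕ) :
    ∑ n ∈ Finset.range (M + 1), grunwaldW α n * n = -α * M / (1 - α) * grunwaldS α M := by
  have : 1 - α ≠ 0 := by linarith
  induction M with
  | zero => simp
  | succ M ih =>
    rw [Finset.sum_range_succ, ih, grunwaldW_succ_eq hα0 hα1, grunwaldS_succ hα1]
    push_cast
    field_simp
    ring

lemma sum_grunwaldW_mul_sq {α : ℝ} (hα0 : 0 < α) (hα1 : α < 1) (M : ℕ) :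
    ∑ n ∈ Finset.range (M + 1), grunwaldW α n * n ^ 2 =
      (2 * M * (M - α / 2) / ((1 - α) * (2 - α)) - M ^ 2 - 2 * M * (α * M / (1 - α)))
        * grunwaldS α M := by
  have : 1 - α ≠ 0 := by linarith
  have : 2 - α ≠ 0 := by linarith
  induction M with
  | zero => simp
  | succ M ih =>
    rw [Finset.sum_range_succ, ih, grunwaldW_succ_eq hα0 hα1, grunwaldS_succ hα1]
    push_cast
    field_simp
    ring

lemma sum_grunwaldW_mul_max {α : ℝ} (hα0 : 0 < α) (hα1 : α < 1) {u : ℝ} (hu : 0 ≤ u) {N : ℕ}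
    (hN : ⌊u⌋₊ ≤ N) :
    ∑ n ∈ Finset.range (N + 1), grunwaldW α n * max (u - n) 0 =
      (u + α * ⌊u⌋₊ / (1 - α)) * grunwaldS α ⌊u⌋₊ := by
  have h1 : ∑ n ∈ Finset.range (⌊u⌋₊ + 1), grunwaldW α n * max (u - n) 0 =
      ∑ n ∈ Finset.range (N + 1), grunwaldW α n * max (u - n) 0 := by
    refine Finset.sum_subset (Finset.range_mono (by omega)) fun n _ hn => ?_
    have : u < n := (Nat.floor_lt hu).1 (by simpa using hn)
    rw [max_eq_right (by linarith), mul_zero]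
  rw [← h1]
  have h2 : ∑ n ∈ Finset.range (⌊u⌋₊ + 1), grunwaldW α n * max (u - n) 0 =
      ∑ n ∈ Finset.range (⌊u⌋₊ + 1), (u * grunwaldW α n - grunwaldW α n * n) := by
    refine Finset.sum_congr rfl fun n hn => ?_
    have : (n : ℝ) ≤ u := (Nat.le_floor_iff hu).1 (by simpa [Nat.lt_succ_iff] using hn)
    rw [max_eq_left (by linarith)]
    ring
  rw [h2, Finset.sum_sub_distrib, ← Finset.mul_sum, sum_grunwaldW hα0 hα1,
    sum_grunwaldW_mul hα0 hα1]
  ring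

lemma sum_grunwaldW_mul_max_sq {α : ℝ} (hα0 : 0 < α) (hα1 : α < 1) {u : ℝ} (hu : 0 ≤ u) {N : ℕ}
    (hN : ⌊u⌋₊ ≤ N) :
    ∑ n ∈ Finset.range (N + 1), grunwaldW α n * (max (u - n) 0 ^ 2 / 2) =
      ((u - ⌊u⌋₊) ^ 2 / 2 + (u - ⌊u⌋₊) * ⌊u⌋₊ / (1 - α)
        + ⌊u⌋₊ * (⌊u⌋₊ - α / 2) / ((1 - α) * (2 - α))) * grunwaldS α ⌊u⌋₊ := by
  have h1 : ∑ n ∈ Finset.range (⌊u⌋₊ + 1), grunwaldW α n * (max (u - n) 0 ^ 2 / 2) =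
      ∑ n ∈ Finset.range (N + 1), grunwaldW α n * (max (u - n) 0 ^ 2 / 2) := by
    refine Finset.sum_subset (Finset.range_mono (by omega)) fun n _ hn => ?_
    have : u < n := (Nat.floor_lt hu).1 (by simpa using hn)
    rw [max_eq_right (by linarith)]
    ring
  rw [← h1]
  have h2 : ∑ n ∈ Finset.range (⌊u⌋₊ + 1), grunwaldW α n * (max (u - n) 0 ^ 2 / 2) =
      ∑ n ∈ Finset.range (⌊u⌋₊ + 1), (u ^ 2 / 2 * grunwaldW α n - u * (grunwaldW α n * n)
        + 1 / 2 * (grunwaldW α n * n ^ 2)) := by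
    refine Finset.sum_congr rfl fun n hn => ?_
    have : (n : ℝ) ≤ u := (Nat.le_floor_iff hu).1 (by simpa [Nat.lt_succ_iff] using hn)
    rw [max_eq_left (by linarith)]
    ring
  have : 1 - α ≠ 0 := by linarith
  rw [h2, Finset.sum_add_distrib, Finset.sum_sub_distrib, ← Finset.mul_sum, ← Finset.mul_sum,
    ← Finset.mul_sum, sum_grunwaldW hα0 hα1,
    sum_grunwaldW_mul hα0 hα1, sum_grunwaldW_mul_sq hα0 hα1]
  field_simp
  ring

lemma abs_log_sub_two_mul_le {x : ℝ} (h0 : 0 ≤ x) (h1 : x ≤ 1 / 2) :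
    |Real.log ((1 + x) / (1 - x)) - 2 * x| ≤ 8 / 3 * x ^ 3 := by
  have h := Real.sum_range_sub_log_div_le (x := x) (by rw [abs_of_nonneg h0]; linarith) 1
  simp only [Finset.sum_range_one, abs_of_nonneg h0] at h
  norm_num at h
  have h2 : x ^ 3 / (1 - x ^ 2) ≤ 4 / 3 * x ^ 3 := by
    rw [div_le_iff₀ (by nlinarith)]
    have : 0 ≤ x ^ 3 := by positivity
    nlinarith [mul_nonneg this (show 0 ≤ 1 / 4 - x ^ 2 by nlinarith)]
  have h3 := abs_le.1 (h.trans h2)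
  rw [abs_le]
  constructor <;> linarith [h3.1, h3.2]

/-- The logarithm of `Γ(t + 1 - α) / (Γ(t) (t - α / 2) ^ (1 - α))`. -/
noncomputable def logGammaRatio (α t : ℝ) : ℝ :=
  Real.log (Real.Gamma (t + 1 - α)) - Real.log (Real.Gamma t) - (1 - α) * Real.log (t - α / 2)

lemma abs_logGammaRatio_succ_sub_le {α : ℝ} (hα0 : 0 < α) (hα1 : α < 1) {t : ℝ} (ht : 1 ≤ t) :
    |logGammaRatio α (t + 1) - logGammaRatio α t| ≤ 1 / t ^ 2 - 1 / (t + 1) ^ 2 := by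
  have ht0 : 0 < t := by linarith
  have hc : 0 < t + (1 - α) / 2 := by linarith
  have hG1 : Real.Gamma (t + 1 - α) ≠ 0 := (Real.Gamma_pos_of_pos (by linarith)).ne'
  have hG2 : Real.Gamma t ≠ 0 := (Real.Gamma_pos_of_pos ht0).ne'
  have bound : ∀ d, 0 ≤ d → d ≤ 1 / 2 → 0 ≤ d / (t + (1 - α) / 2) ∧
      d / (t + (1 - α) / 2) ≤ 1 / (2 * t) := by
    intro d hd0 hd1
    refine ⟨by positivity, ?_⟩
    rw [div_le_div_iff₀ hc (by positivity)]
    nlinarith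
  have cube : ∀ x : ℝ, 0 ≤ x ∧ x ≤ 1 / (2 * t) →
      |Real.log ((1 + x) / (1 - x)) - 2 * x| ≤ 1 / (3 * t ^ 3) := by
    rintro x ⟨h0, h1⟩
    have h2 : 1 / (2 * t) ≤ 1 / 2 := by
      rw [div_le_div_iff₀ (by positivity) (by norm_num)]; linarith
    refine (abs_log_sub_two_mul_le h0 (h1.trans h2)).trans ?_
    have : x ^ 3 ≤ (1 / (2 * t)) ^ 3 := by gcongr
    have h4 : 8 / 3 * (1 / (2 * t)) ^ 3 = 1 / (3 * t ^ 3) := by field_simp; norm_num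
    linarith
  have e1 := cube _ (bound ((1 - α) / 2) (by linarith) (by linarith))
  have e2 := cube _ (bound (1 / 2) (by norm_num) le_rfl)
  have key : logGammaRatio α (t + 1) - logGammaRatio α t =
      (Real.log ((1 + (1 - α) / 2 / (t + (1 - α) / 2)) / (1 - (1 - α) / 2 / (t + (1 - α) / 2)))
        - 2 * ((1 - α) / 2 / (t + (1 - α) / 2))) -
      (1 - α) * (Real.log ((1 + 1 / 2 / (t + (1 - α) / 2)) / (1 - 1 / 2 / (t + (1 - α) / 2)))
        - 2 * (1 / 2 / (t + (1 - α) / 2))) := by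
    have r : ∀ d, (1 + d / (t + (1 - α) / 2)) / (1 - d / (t + (1 - α) / 2))
        = (t + (1 - α) / 2 + d) / (t + (1 - α) / 2 - d) := fun d => by
      rw [one_add_div hc.ne', one_sub_div hc.ne', div_div_div_cancel_right₀ hc.ne']
    have r1 := r ((1 - α) / 2)
    have r2 := r (1 / 2)
    rw [show t + (1 - α) / 2 + (1 - α) / 2 = t + 1 - α by ring,
      show t + (1 - α) / 2 - (1 - α) / 2 = t by ring] at r1
    rw [show t + (1 - α) / 2 + 1 / 2 = t + 1 - α / 2 by ring,
      show t + (1 - α) / 2 - 1 / 2 = t - α / 2 by ring] at r2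
    rw [r1, r2, Real.log_div (by linarith) ht0.ne', Real.log_div (by linarith) (by linarith)]
    unfold logGammaRatio
    rw [show t + 1 + 1 - α = t + 1 - α + 1 by ring, Real.Gamma_add_one (by linarith),
      Real.Gamma_add_one ht0.ne', Real.log_mul (by linarith) hG1, Real.log_mul ht0.ne' hG2]
    ring
  have h3 : 1 / (3 * t ^ 3) + 1 / (3 * t ^ 3) ≤ 1 / t ^ 2 - 1 / (t + 1) ^ 2 := by
    rw [div_add_div _ _ (by positivity) (by positivity),
      div_sub_div _ _ (by positivity) (by positivity),
      div_le_div_iff₀ (by positivity) (by positivity)]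
    have : 0 ≤ 3 * t ^ 5 * (4 * t ^ 2 - t - 2) := by
      have : 0 ≤ 4 * t ^ 2 - t - 2 := by nlinarith
      positivity
    nlinarith
  rw [key]
  refine (abs_sub _ _).trans (le_trans (add_le_add e1 ?_) h3)
  rw [abs_mul, abs_of_pos (by linarith : 0 < 1 - α)]
  calc _ ≤ 1 * (1 / (3 * t ^ 3)) := by gcongr; linarith
    _ = _ := one_mul _

lemma abs_logGammaRatio_le_two_div {α : ℝ} (hα0 : 0 < α) (hα1 : α < 1) {t : ℝ} (ht : 1 ≤ t) :
    |logGammaRatio α t| ≤ 2 / t := by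
  have ht0 : 0 < t := by linarith
  have hv : 0 < t - α / 2 := by linarith
  have hG1 : Real.Gamma (t + 1 - α) ≠ 0 := (Real.Gamma_pos_of_pos (by linarith)).ne'
  have hG2 : Real.Gamma t ≠ 0 := (Real.Gamma_pos_of_pos ht0).ne'
  have c1 := Real.convexOn_log_Gamma.2 (show t ∈ Set.Ioi 0 from ht0)
    (show t + 1 ∈ Set.Ioi (0 : ℝ) from by simp; linarith) hα0.le
    (show 0 ≤ 1 - α by linarith) (by ring)
  have c2 := Real.convexOn_log_Gamma.2 (show t + 1 - α ∈ Set.Ioi (0 : ℝ) from by simp; linarith)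
    (show t + 1 - α + 1 ∈ Set.Ioi (0 : ℝ) from by simp; linarith)
    (show 0 ≤ 1 - α by linarith) hα0.le (by ring)
  simp only [smul_eq_mul, Function.comp] at c1 c2
  rw [show α * t + (1 - α) * (t + 1) = t + 1 - α by ring, Real.Gamma_add_one ht0.ne',
    Real.log_mul ht0.ne' hG2] at c1
  rw [show (1 - α) * (t + 1 - α) + α * (t + 1 - α + 1) = t + 1 by ring,
    Real.Gamma_add_one ht0.ne', Real.Gamma_add_one (by linarith),
    Real.log_mul ht0.ne' hG2, Real.log_mul (by linarith) hG1] at c2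
  have l1 : Real.log (t - α / 2) ≤ Real.log t := Real.log_le_log hv (by linarith)
  have lgap : ∀ s, t - α / 2 ≤ s → s ≤ t - α / 2 + 1 →
      Real.log s - Real.log (t - α / 2) ≤ 2 / t := by
    intro s h0 h1
    rw [← Real.log_div (by linarith) hv.ne']
    have h2 := Real.log_le_sub_one_of_pos (show 0 < s / (t - α / 2) by
      have : 0 < s := by linarith
      positivity)
    refine h2.trans ?_
    rw [div_sub_one hv.ne', div_le_div_iff₀ hv ht0]
    nlinarith
  have l2 := lgap t (by linarith) (by linarith)
  have l3 := lgap (t + 1 - α) (by linarith) (by linarith)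
  unfold logGammaRatio
  rw [abs_le]
  constructor
  · nlinarith
  · nlinarith

lemma abs_logGammaRatio_le {α : ℝ} (hα0 : 0 < α) (hα1 : α < 1) {M : ℕ} (hM : 1 ≤ M) :
    |logGammaRatio α M| ≤ 1 / (M : ℝ) ^ 2 := by
  have step : ∀ n : ℕ, |logGammaRatio α ((M + n : ℕ) : ℝ) - logGammaRatio α M|
      ≤ 1 / (M : ℝ) ^ 2 - 1 / ((M + n : ℕ) : ℝ) ^ 2 := by
    intro n
    induction n with
    | zero => simp
    | succ n ih =>
      have h1 : (1 : ℝ) ≤ ((M + n : ℕ) : ℝ) := by exact_mod_cast (by omega : 1 ≤ M + n)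
      have h2 := abs_logGammaRatio_succ_sub_le hα0 hα1 h1
      rw [← add_assoc, Nat.cast_succ]
      refine (abs_sub_le _ (logGammaRatio α ((M + n : ℕ) : ℝ)) _).trans ?_
      linarith
  have lim1 : Filter.Tendsto (fun n : ℕ => 2 / ((M + n : ℕ) : ℝ)) Filter.atTop (nhds 0) := by
    refine Filter.Tendsto.div_atTop tendsto_const_nhds
      (tendsto_natCast_atTop_atTop.comp ?_)
    exact Filter.tendsto_atTop_mono (fun n => Nat.le_add_left n M) Filter.tendsto_id
  have h : ∀ n : ℕ, |logGammaRatio α M| ≤ 1 / (M : ℝ) ^ 2 + 2 / ((M + n : ℕ) : ℝ) := by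
    intro n
    have h1 : (1 : ℝ) ≤ ((M + n : ℕ) : ℝ) := by exact_mod_cast (by omega : 1 ≤ M + n)
    have h2 := abs_logGammaRatio_le_two_div hα0 hα1 h1
    have h3 := step n
    have h4 : 0 ≤ 1 / ((M + n : ℕ) : ℝ) ^ 2 := by positivity
    have h5 := abs_sub_abs_le_abs_sub (logGammaRatio α M) (logGammaRatio α ((M + n : ℕ) : ℝ))
    rw [abs_sub_comm] at h5
    linarith
  have := ge_of_tendsto' (lim1.const_add (1 / (M : ℝ) ^ 2)) h
  simpa using this

lemma abs_grunwaldS_sub_le {α : ℝ} (hα0 : 0 < α) (hα1 : α < 1) {M : ℕ} (hM : 1 ≤ M) :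
    |Real.Gamma (1 - α) * M * grunwaldS α M - (M - α / 2) ^ (1 - α)|
      ≤ 2 * (M - α / 2) ^ (1 - α) / (M : ℝ) ^ 2 := by
  have h1 : (1 : ℝ) ≤ M := by exact_mod_cast hM
  have hM0 : (0 : ℝ) < M := by linarith
  have hv : 0 < M - α / 2 := by linarith
  have hG1 := Real.Gamma_pos_of_pos (show 0 < M + 1 - α by linarith)
  have hG2 := Real.Gamma_pos_of_pos hM0
  have hG3 := Real.Gamma_pos_of_pos (show 0 < 1 - α by linarith)
  have ha := abs_logGammaRatio_le hα0 hα1 hM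
  have hle : 1 / (M : ℝ) ^ 2 ≤ 1 := by
    rw [div_le_one (by positivity)]; nlinarith
  have hexp : Real.Gamma (1 - α) * M * grunwaldS α M =
      (M - α / 2) ^ (1 - α) * Real.exp (logGammaRatio α M) := by
    unfold logGammaRatio grunwaldS
    rw [Real.rpow_def_of_pos hv, ← Real.exp_add, Real.Gamma_add_one hM0.ne',
      show Real.log (M - α / 2) * (1 - α) + (Real.log (Real.Gamma (M + 1 - α)) -
        Real.log (Real.Gamma M) - (1 - α) * Real.log (M - α / 2)) =
        Real.log (Real.Gamma (M + 1 - α)) - Real.log (Real.Gamma M) by ring, Real.exp_sub,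
      Real.exp_log hG1, Real.exp_log hG2]
    field_simp
  rw [hexp, show (M - α / 2) ^ (1 - α) * Real.exp (logGammaRatio α M) - (M - α / 2) ^ (1 - α)
    = (M - α / 2) ^ (1 - α) * (Real.exp (logGammaRatio α M) - 1) by ring, abs_mul,
    abs_of_pos (by positivity), show 2 * (M - α / 2) ^ (1 - α) / (M : ℝ) ^ 2 =
    (M - α / 2) ^ (1 - α) * (2 * (1 / (M : ℝ) ^ 2)) by ring]
  gcongr
  exact (Real.abs_exp_sub_one_le (ha.trans hle)).trans (by gcongr)

lemma abs_one_add_rpow_sub_le {β s : ℝ} (hβ0 : 0 ≤ β) (hβ1 : β ≤ 1) (hs : 0 ≤ s) :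
    |(1 + s) ^ β - (1 + β * s)| ≤ s ^ 2 := by
  have h1 := rpow_one_add_le_one_add_mul_self (by linarith : -1 ≤ s) hβ0 hβ1
  have h2 := rpow_one_add_le_one_add_mul_self (by linarith : -1 ≤ s)
    (by linarith : 0 ≤ 1 - β) (by linarith)
  have h3 : (1 + s) ^ β * (1 + s) ^ (1 - β) = 1 + s := by
    rw [← Real.rpow_add (by linarith)]; simp
  have h4 : 0 ≤ (1 + s) ^ β := by positivity
  have h5 : 0 ≤ (1 - β) * s := mul_nonneg (by linarith) hs
  rw [abs_le]
  constructor <;> nlinarith [mul_nonneg hβ0 (sq_nonneg s)]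

/-- Relative expansions of the partial sums of the weights and of the shifted power
at `u ≥ 1`, around the midpoint `⌊u⌋ - α / 2`. -/
lemma exists_expansion {α : ℝ} (hα0 : 0 < α) (hα1 : α < 1) {u : ℝ} (hu : 1 ≤ u) :
    ∃ V κ ρ : ℝ, 0 ≤ V ∧ V ≤ (⌊u⌋₊ : ℝ) ^ (1 - α) ∧
      |κ| ≤ 2 / (⌊u⌋₊ : ℝ) ^ 2 ∧ |ρ| ≤ 4 / (⌊u⌋₊ : ℝ) ^ 2 ∧
      Real.Gamma (1 - α) * ⌊u⌋₊ * grunwaldS α ⌊u⌋₊ = V * (1 + κ) ∧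
      (u - α / 2) ^ (1 - α) = V * (1 + (1 - α) * (u - ⌊u⌋₊) / (⌊u⌋₊ - α / 2) + ρ) := by
  have hM : 1 ≤ ⌊u⌋₊ := (Nat.one_le_floor_iff _).2 hu
  have hMu := Nat.floor_le (by linarith : 0 ≤ u)
  have huM := Nat.lt_floor_add_one u
  have hR := abs_grunwaldS_sub_le hα0 hα1 hM
  generalize ⌊u⌋₊ = M at *
  have h1 : (1 : ℝ) ≤ M := by exact_mod_cast hM
  have hv : 0 < M - α / 2 := by linarith
  have hV : 0 < (M - α / 2) ^ (1 - α) := by positivity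
  have hs : 0 ≤ (u - M) / (M - α / 2) := div_nonneg (by linarith) hv.le
  have hsle : (u - M) / (M - α / 2) ≤ 2 / M := by
    rw [div_le_div_iff₀ hv (by linarith)]; nlinarith
  refine ⟨(M - α / 2) ^ (1 - α),
    Real.Gamma (1 - α) * M * grunwaldS α M / (M - α / 2) ^ (1 - α) - 1,
    (1 + (u - M) / (M - α / 2)) ^ (1 - α) - (1 + (1 - α) * ((u - M) / (M - α / 2))),
    hV.le, ?_, ?_, ?_, ?_, ?_⟩
  · exact Real.rpow_le_rpow hv.le (by linarith) (by linarith)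
  · rw [div_sub_one hV.ne', abs_div, abs_of_pos hV, div_le_iff₀ hV]
    refine hR.trans (le_of_eq ?_)
    ring
  · refine (abs_one_add_rpow_sub_le (by linarith) (by linarith) hs).trans ?_
    calc _ ≤ (2 / (M : ℝ)) ^ 2 := by gcongr
      _ = _ := by ring
  · rw [add_sub_cancel, ← mul_div_assoc, mul_div_cancel_left₀ _ hV.ne']
  · rw [show u - α / 2 = (M - α / 2) * (1 + (u - M) / (M - α / 2)) by
        rw [mul_add, ← mul_div_assoc, mul_div_cancel_left₀ _ hv.ne']; ring,
      Real.mul_rpow hv.le (by linarith)]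
    ring

lemma natFloor_rpow_neg_le {u r : ℝ} (hu : 1 ≤ u) (hr : 0 ≤ r) :
    (⌊u⌋₊ : ℝ) ^ (-r) ≤ 2 ^ r * u ^ (-r) := by
  have h1 : (1 : ℝ) ≤ ⌊u⌋₊ := by exact_mod_cast (Nat.one_le_floor_iff _).2 hu
  have huM := Nat.lt_floor_add_one u
  rw [show (2 : ℝ) ^ r * u ^ (-r) = (u / 2) ^ (-r) by
    rw [Real.div_rpow (by linarith) (by norm_num), Real.rpow_neg (by norm_num : (0 : ℝ) ≤ 2)]
    field_simp]
  exact Real.rpow_le_rpow_of_nonpos (by linarith) (by linarith) (by linarith)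

lemma abs_sum_grunwaldW_mul_max_sub_le {α : ℝ} (hα0 : 0 < α) (hα1 : α < 1) {u : ℝ} (hu : 1 ≤ u)
    {N : ℕ} (hN : ⌊u⌋₊ ≤ N) :
    |∑ n ∈ Finset.range (N + 1), grunwaldW α n * max (u - n) 0
        - max (u - α / 2) 0 ^ (1 - α) / Real.Gamma (2 - α)|
      ≤ 36 / Real.Gamma (2 - α) * u ^ (-(1 + α)) := by
  rw [sum_grunwaldW_mul_max hα0 hα1 (by linarith) hN, max_eq_left (by linarith)]
  obtain ⟨V, κ, ρ, hV0, hV, hκ, hρ, hS, hP⟩ := exists_expansion hα0 hα1 hu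
  have hpow := natFloor_rpow_neg_le hu (by linarith : 0 ≤ 1 + α)
  have hM : 1 ≤ ⌊u⌋₊ := (Nat.one_le_floor_iff _).2 hu
  have hMu := Nat.floor_le (by linarith : 0 ≤ u)
  have huM := Nat.lt_floor_add_one u
  generalize ⌊u⌋₊ = M at *
  have h1 : (1 : ℝ) ≤ M := by exact_mod_cast hM
  have hM0 : (0 : ℝ) < M := by linarith
  have hv : 0 < M - α / 2 := by linarith
  have hβ : 0 < 1 - α := by linarith
  have hG : Real.Gamma (2 - α) = (1 - α) * Real.Gamma (1 - α) := by
    rw [show 2 - α = 1 - α + 1 by ring, Real.Gamma_add_one hβ.ne']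
  have hG2 : 0 < Real.Gamma (2 - α) := by rw [hG]; positivity
  have hSe : grunwaldS α M = V * (1 + κ) / (Real.Gamma (1 - α) * M) := by
    rw [← hS]; field_simp
  have key : (u + α * M / (1 - α)) * grunwaldS α M - (u - α / 2) ^ (1 - α) / Real.Gamma (2 - α)
      = V / Real.Gamma (2 - α) * (κ * (1 + (1 - α) * (u - M) / M)
        - (1 - α) * (u - M) * (α / 2) / (M * (M - α / 2)) - ρ) := by
    rw [hSe, hP, hG]
    generalize hvv : (M : ℝ) - α / 2 = v at *
    have hal : α / 2 = M - v := by linarith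
    rw [hal]
    field_simp
    ring
  have b1 : |κ * (1 + (1 - α) * (u - M) / M)| ≤ 4 / (M : ℝ) ^ 2 := by
    have : 0 ≤ (1 - α) * (u - M) / M := by
      positivity
    have h2 : (1 - α) * (u - M) / M ≤ 1 := by
      rw [div_le_one hM0]; nlinarith
    rw [abs_mul, abs_of_nonneg (by linarith : 0 ≤ 1 + (1 - α) * (u - M) / M)]
    calc _ ≤ 2 / (M : ℝ) ^ 2 * 2 := by gcongr; linarith
      _ = _ := by ring
  have b2 : |(1 - α) * (u - M) * (α / 2) / (M * (M - α / 2))| ≤ 1 / (M : ℝ) ^ 2 := by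
    rw [abs_of_nonneg (by positivity), div_le_div_iff₀ (by positivity) (by positivity)]
    have h3 : (1 - α) * (u - M) * (α / 2) ≤ 1 * 1 * (1 / 2) := by gcongr <;> linarith
    nlinarith
  have b3 : |κ * (1 + (1 - α) * (u - M) / M)
        - (1 - α) * (u - M) * (α / 2) / (M * (M - α / 2)) - ρ| ≤ 9 / (M : ℝ) ^ 2 := by
    refine (abs_sub _ _).trans ((add_le_add ((abs_sub _ _).trans (add_le_add b1 b2)) hρ).trans ?_)
    rw [← add_div, ← add_div]
    norm_num
  rw [key, abs_mul, abs_of_nonneg (by positivity)]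
  have h2 : (2 : ℝ) ^ (1 + α) ≤ 4 := by
    calc (2 : ℝ) ^ (1 + α) ≤ 2 ^ (2 : ℝ) :=
          Real.rpow_le_rpow_of_exponent_le (by norm_num) (by linarith)
      _ = 4 := by norm_num
  have h3 : (M : ℝ) ^ (1 - α) / (M : ℝ) ^ 2 = (M : ℝ) ^ (-(1 + α)) := by
    rw [← Real.rpow_natCast, ← Real.rpow_sub hM0]
    congr 1
    push_cast
    ring
  calc _ ≤ (M : ℝ) ^ (1 - α) / Real.Gamma (2 - α) * (9 / (M : ℝ) ^ 2) := by gcongr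
    _ = 9 / Real.Gamma (2 - α) * (M : ℝ) ^ (-(1 + α)) := by rw [← h3]; ring
    _ ≤ 9 / Real.Gamma (2 - α) * (4 * u ^ (-(1 + α))) := by
      gcongr
      exact hpow.trans (by gcongr)
    _ = _ := by ring

lemma abs_sum_grunwaldW_mul_max_sq_sub_le_of_one_le {α : ℝ} (hα0 : 0 < α) (hα1 : α < 1) {u : ℝ}
    (hu : 1 ≤ u) {N : ℕ} (hN : ⌊u⌋₊ ≤ N) :
    |∑ n ∈ Finset.range (N + 1), grunwaldW α n * (max (u - n) 0 ^ 2 / 2)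
        - max (u - α / 2) 0 ^ (2 - α) / Real.Gamma (3 - α)|
      ≤ 40 / Real.Gamma (3 - α) * u ^ (-α) := by
  rw [sum_grunwaldW_mul_max_sq hα0 hα1 (by linarith) hN, max_eq_left (by linarith),
    show 2 - α = 1 - α + 1 by ring, Real.rpow_add_one (by linarith),
    show 1 - α + 1 = 2 - α by ring]
  obtain ⟨V, κ, ρ, hV0, hV, hκ, hρ, hS, hP⟩ := exists_expansion hα0 hα1 hu
  have hpow := natFloor_rpow_neg_le hu hα0.le
  have hM : 1 ≤ ⌊u⌋₊ := (Nat.one_le_floor_iff _).2 hu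
  have hMu := Nat.floor_le (by linarith : 0 ≤ u)
  have huM := Nat.lt_floor_add_one u
  generalize ⌊u⌋₊ = M at *
  have h1 : (1 : ℝ) ≤ M := by exact_mod_cast hM
  have hM0 : (0 : ℝ) < M := by linarith
  have hv : 0 < M - α / 2 := by linarith
  have hβ : 0 < 1 - α := by linarith
  have hβ2 : 0 < 2 - α := by linarith
  have hG : Real.Gamma (3 - α) = (2 - α) * ((1 - α) * Real.Gamma (1 - α)) := by
    rw [show 3 - α = 2 - α + 1 by ring, Real.Gamma_add_one hβ2.ne',
      show 2 - α = 1 - α + 1 by ring, Real.Gamma_add_one hβ.ne']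
  have hG2 : 0 < Real.Gamma (3 - α) := by rw [hG]; positivity
  have hSe : grunwaldS α M = V * (1 + κ) / (Real.Gamma (1 - α) * M) := by
    rw [← hS]; field_simp
  have key : ((u - M) ^ 2 / 2 + (u - M) * M / (1 - α) + M * (M - α / 2) / ((1 - α) * (2 - α)))
        * grunwaldS α M - (u - α / 2) ^ (1 - α) * (u - α / 2) / Real.Gamma (3 - α)
      = V / Real.Gamma (3 - α) * (κ * (M - α / 2 + (2 - α) * (u - M)
          + (1 - α) * (2 - α) * (u - M) ^ 2 / (2 * M))
        + (1 - α) * (2 - α) * (u - M) ^ 2 / (2 * M)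
        - (1 - α) * (u - M) ^ 2 / (M - α / 2) - (u - α / 2) * ρ) := by
    rw [hSe, hP, hG]
    rw [show u - α / 2 = (M - α / 2) + (u - M) by ring]
    generalize (M : ℝ) - α / 2 = v at *
    field_simp
    ring
  have hsq : (u - M) ^ 2 ≤ 1 := by nlinarith
  have c1 : (1 - α) * (2 - α) * (u - M) ^ 2 / (2 * M) ≤ 1 / M := by
    rw [div_le_div_iff₀ (by positivity) hM0]
    have : (1 - α) * (2 - α) * (u - M) ^ 2 ≤ 1 * 2 * 1 := by gcongr <;> linarith
    nlinarith
  have c0 : 0 ≤ (1 - α) * (2 - α) * (u - M) ^ 2 / (2 * M) := by positivity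
  have hM1 : 1 / (M : ℝ) ≤ 1 := by rw [div_le_one hM0]; exact h1
  have b1 : |κ * (M - α / 2 + (2 - α) * (u - M)
      + (1 - α) * (2 - α) * (u - M) ^ 2 / (2 * M))| ≤ 8 / (M : ℝ) := by
    have h3 : (2 - α) * (u - M) ≤ 2 * 1 := by gcongr <;> linarith
    have h4 : 0 ≤ (2 - α) * (u - M) := by positivity
    rw [abs_mul, abs_of_nonneg (by linarith : 0 ≤ M - α / 2 + (2 - α) * (u - M)
      + (1 - α) * (2 - α) * (u - M) ^ 2 / (2 * M))]
    calc _ ≤ 2 / (M : ℝ) ^ 2 * (4 * M) := by gcongr; linarith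
      _ = _ := by field_simp; norm_num
  have b3 : |(1 - α) * (u - M) ^ 2 / (M - α / 2)| ≤ 2 / (M : ℝ) := by
    rw [abs_of_nonneg (by positivity), div_le_div_iff₀ hv hM0]
    have : (1 - α) * (u - M) ^ 2 ≤ 1 * 1 := by gcongr; linarith
    have := mul_le_mul_of_nonneg_right this hM0.le
    linarith
  have b4 : |(u - α / 2) * ρ| ≤ 8 / (M : ℝ) := by
    rw [abs_mul, abs_of_nonneg (by linarith)]
    calc _ ≤ (2 * (M : ℝ)) * (4 / (M : ℝ) ^ 2) := by gcongr; linarith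
      _ = _ := by field_simp; norm_num
  have b5 : |κ * (M - α / 2 + (2 - α) * (u - M)
          + (1 - α) * (2 - α) * (u - M) ^ 2 / (2 * M))
        + (1 - α) * (2 - α) * (u - M) ^ 2 / (2 * M)
        - (1 - α) * (u - M) ^ 2 / (M - α / 2) - (u - α / 2) * ρ| ≤ 20 / (M : ℝ) := by
    have b2 := (abs_of_nonneg c0).le.trans c1
    refine (abs_sub _ _).trans ((add_le_add ((abs_sub _ _).trans
      (add_le_add ((abs_add_le _ _).trans (add_le_add b1 b2)) b3)) b4).trans ?_)
    rw [← add_div, ← add_div, ← add_div]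
    gcongr
    norm_num
  rw [key, abs_mul, abs_of_nonneg (by positivity)]
  have h2 : (2 : ℝ) ^ α ≤ 2 := by
    calc (2 : ℝ) ^ α ≤ 2 ^ (1 : ℝ) :=
          Real.rpow_le_rpow_of_exponent_le (by norm_num) (by linarith)
      _ = 2 := by norm_num
  have h3 : (M : ℝ) ^ (1 - α) / M = (M : ℝ) ^ (-α) := by
    rw [div_eq_iff hM0.ne', ← Real.rpow_add_one hM0.ne']
    congr 1
    ring
  calc _ ≤ (M : ℝ) ^ (1 - α) / Real.Gamma (3 - α) * (20 / (M : ℝ)) := by gcongr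
    _ = 20 / Real.Gamma (3 - α) * (M : ℝ) ^ (-α) := by rw [← h3]; ring
    _ ≤ 20 / Real.Gamma (3 - α) * (2 * u ^ (-α)) := by
      gcongr
      exact hpow.trans (by gcongr)
    _ = _ := by ring

lemma abs_sum_grunwaldW_mul_max_sq_sub_le {α : ℝ} (hα0 : 0 < α) (hα1 : α < 1) {u : ℝ}
    (hu : 0 < u) {N : ℕ} (hN : ⌊u⌋₊ ≤ N) :
    |∑ n ∈ Finset.range (N + 1), grunwaldW α n * (max (u - n) 0 ^ 2 / 2)
        - max (u - α / 2) 0 ^ (2 - α) / Real.Gamma (3 - α)|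
      ≤ (1 + 40 / Real.Gamma (3 - α)) * u ^ (-α) := by
  have hG := Real.Gamma_pos_of_pos (by linarith : 0 < 3 - α)
  rcases le_or_gt 1 u with h1 | h1
  · refine (abs_sum_grunwaldW_mul_max_sq_sub_le_of_one_le hα0 hα1 h1 hN).trans ?_
    gcongr
    linarith
  · have hf : ⌊u⌋₊ = 0 := Nat.floor_eq_zero.2 h1
    rw [sum_grunwaldW_mul_max_sq hα0 hα1 hu.le hN, hf, grunwaldS_zero hα1]
    have hpow : 1 ≤ u ^ (-α) := by
      rw [Real.rpow_neg hu.le]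
      exact (one_le_inv₀ (by positivity)).2 (Real.rpow_le_one hu.le h1.le hα0.le)
    have h2 : max (u - α / 2) 0 ^ (2 - α) ≤ 1 :=
      Real.rpow_le_one (le_max_right _ _) (max_le (by linarith) (by norm_num)) (by linarith)
    calc _ ≤ 1 + 1 / Real.Gamma (3 - α) := by
          refine (abs_sub _ _).trans (add_le_add ?_ ?_)
          · rw [abs_of_nonneg (by simp; positivity)]
            simp
            nlinarith
          · rw [abs_of_nonneg (by positivity)]
            gcongr
      _ ≤ (1 + 40 / Real.Gamma (3 - α)) * 1 := by
        rw [mul_one]; gcongr; norm_num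
      _ ≤ _ := by gcongr

lemma abs_grunwaldW_le {α : ℝ} (hα0 : 0 < α) (hα1 : α < 1) {n : ℕ} (hn : 1 ≤ n) :
    |grunwaldW α n| ≤ 3 / Real.Gamma (2 - α) * (n : ℝ) ^ (-(1 + α)) := by
  have h1 : (1 : ℝ) ≤ n := by exact_mod_cast hn
  have hM0 : (0 : ℝ) < n := by linarith
  have hβ : 0 < 1 - α := by linarith
  have hG1 := Real.Gamma_pos_of_pos hβ
  have hG : Real.Gamma (2 - α) = (1 - α) * Real.Gamma (1 - α) := by
    rw [show 2 - α = 1 - α + 1 by ring, Real.Gamma_add_one hβ.ne']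
  have hnα : 0 < n - α := by linarith
  obtain ⟨V, κ, ρ, hV0, hV, hκ, -, hS, -⟩ := exists_expansion hα0 hα1 h1
  rw [Nat.floor_natCast] at *
  have hκ2 : 1 + κ ≤ 3 := by
    have : 2 / (n : ℝ) ^ 2 ≤ 2 := by
      rw [div_le_iff₀ (by positivity)]; nlinarith
    linarith [le_abs_self κ]
  have hSle : Real.Gamma (1 - α) * n * grunwaldS α n ≤ 3 * (n : ℝ) ^ (1 - α) := by
    rw [hS]; nlinarith
  have hw : grunwaldW α n = -(α * grunwaldS α n / (n - α)) := by
    rw [← neg_div, eq_div_iff hnα.ne']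
    linear_combination grunwaldW_eq hα0 hα1 n
  have hS0 := grunwaldS_pos hα1 n
  have h3 : (n : ℝ) ^ (1 - α) = (n : ℝ) ^ (-(1 + α)) * n ^ 2 := by
    rw [← Real.rpow_natCast, ← Real.rpow_add hM0]
    congr 1
    push_cast
    ring
  rw [hw, abs_neg, abs_of_nonneg (by positivity), hG, div_le_iff₀ hnα]
  have h4 : (1 - α) * n ≤ n - α := by nlinarith
  have h5 : grunwaldS α n ≤ 3 * (n : ℝ) ^ (-(1 + α)) * n / Real.Gamma (1 - α) := by
    rw [le_div_iff₀ hG1]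
    rw [h3] at hSle
    have : (grunwaldS α n * Real.Gamma (1 - α)) * n ≤ (3 * (n : ℝ) ^ (-(1 + α)) * n) * n := by
      linarith
    exact le_of_mul_le_mul_right this hM0
  calc α * grunwaldS α n ≤ 1 * grunwaldS α n := by gcongr
    _ ≤ 3 * (n : ℝ) ^ (-(1 + α)) * n / Real.Gamma (1 - α) := by rwa [one_mul]
    _ = 3 / ((1 - α) * Real.Gamma (1 - α)) * (n : ℝ) ^ (-(1 + α)) * ((1 - α) * n) := by
      field_simp
    _ ≤ _ := by gcongr

lemma contDiffOn_derivWithin_Icc {f : ℝ → ℝ} {b X : ℝ} (hbX : b < X) {n : ℕ}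
    (hf : ContDiffOn ℝ (n + 1) f (Set.Icc b X)) :
    ContDiffOn ℝ n (derivWithin f (Set.Icc b X)) (Set.Icc b X) ∧
      ∀ t ∈ Set.Ioo b X, HasDerivAt f (derivWithin f (Set.Icc b X) t) t := by
  refine ⟨hf.derivWithin (uniqueDiffOn_Icc hbX) le_rfl, fun t ht => ?_⟩
  have hd : DifferentiableWithinAt ℝ f (Set.Icc b X) t :=
    (hf.differentiableOn (by simp)) t (Set.Ioo_subset_Icc_self ht)
  exact hd.hasDerivWithinAt.hasDerivAt (Icc_mem_nhds ht.1 ht.2)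

/-- Derivatives up to order three on `[b, X]`, in the one-sided sense at the endpoints. -/
structure HasDerivsOn (y y1 y2 y3 : ℝ → ℝ) (b X : ℝ) : Prop where
  cont : ContinuousOn y (Set.Icc b X)
  cont1 : ContinuousOn y1 (Set.Icc b X)
  cont2 : ContinuousOn y2 (Set.Icc b X)
  cont3 : ContinuousOn y3 (Set.Icc b X)
  deriv1 : ∀ t ∈ Set.Ioo b X, HasDerivAt y (y1 t) t
  deriv2 : ∀ t ∈ Set.Ioo b X, HasDerivAt y1 (y2 t) t
  deriv3 : ∀ t ∈ Set.Ioo b X, HasDerivAt y2 (y3 t) t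

lemma exists_hasDerivsOn {y : ℝ → ℝ} {b X : ℝ} (hbX : b < X)
    (hy : ContDiffOn ℝ 3 y (Set.Icc b X)) : ∃ y1 y2 y3, HasDerivsOn y y1 y2 y3 b X := by
  obtain ⟨h1, d1⟩ := contDiffOn_derivWithin_Icc hbX (n := 2) (hy.of_le (by norm_num))
  obtain ⟨h2, d2⟩ := contDiffOn_derivWithin_Icc hbX (n := 1) (h1.of_le (by norm_num))
  obtain ⟨h3, d3⟩ := contDiffOn_derivWithin_Icc hbX (n := 0) (h2.of_le (by norm_num))
  exact ⟨_, _, _, hy.continuousOn, h1.continuousOn, h2.continuousOn, h3.continuousOn, d1, d2, d3⟩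

namespace HasDerivsOn

variable {y y1 y2 y3 : ℝ → ℝ} {b X : ℝ}

lemma intervalIntegrable_mul_max_rpow (H : HasDerivsOn y y1 y2 y3 b X) {T : ℝ} (hbT : b ≤ T)
    (hTX : T ≤ X) (t : ℝ) {r : ℝ} (hr : 0 ≤ r) :
    IntervalIntegrable (fun s => y3 s * max (t - s) 0 ^ r) MeasureTheory.volume b T := by
  refine ContinuousOn.intervalIntegrable_of_Icc hbT (ContinuousOn.mul
    (H.cont3.mono (Set.Icc_subset_Icc_right hTX)) ?_)
  refine Continuous.continuousOn ?_
  exact ((continuous_const.sub continuous_id).max continuous_const).rpow_const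
    fun _ => Or.inr hr

lemma integral_max_eq (H : HasDerivsOn y y1 y2 y3 b X) {t T : ℝ} (hbt : b ≤ t) (htT : t ≤ T)
    (hTX : T ≤ X) {r : ℝ} (hr : 0 < r) :
    ∫ s in b..T, y3 s * max (t - s) 0 ^ r = ∫ s in b..t, y3 s * (t - s) ^ r := by
  have hI := H.intervalIntegrable_mul_max_rpow (hbt.trans htT) hTX t hr.le
  rw [← intervalIntegral.integral_add_adjacent_intervals (b := t)
    (H.intervalIntegrable_mul_max_rpow hbt (htT.trans hTX) t hr.le)
    (hI.mono_set (by
      rw [Set.uIcc_of_le htT, Set.uIcc_of_le (hbt.trans htT)]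
      exact Set.Icc_subset_Icc_left hbt))]
  have h0 : ∫ s in t..T, y3 s * max (t - s) 0 ^ r = 0 := by
    rw [intervalIntegral.integral_congr (g := fun _ => (0 : ℝ)), intervalIntegral.integral_zero]
    intro s hs
    rw [Set.uIcc_of_le htT] at hs
    simp [max_eq_right (by linarith [hs.1] : t - s ≤ 0), Real.zero_rpow hr.ne']
  rw [h0, add_zero]
  refine intervalIntegral.integral_congr fun s hs => ?_
  rw [Set.uIcc_of_le hbt] at hs
  rw [max_eq_left (by linarith [hs.2])]

/-- Integrating twice by parts against a power kernel. -/
lemma integral_mul_rpow_eq (H : HasDerivsOn y y1 y2 y3 b X) {z : ℝ} (hbz : b < z) (hzX : z ≤ X)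
    {r : ℝ} (hr : -1 < r) :
    ∫ ξ in b..z, y1 ξ * (z - ξ) ^ r =
      y1 b * ((z - b) ^ (r + 1) / (r + 1)) + y2 b * ((z - b) ^ (r + 2) / ((r + 1) * (r + 2)))
        + (∫ s in b..z, y3 s * (z - s) ^ (r + 2)) / ((r + 1) * (r + 2)) := by
  have hr1 : r + 1 ≠ 0 := by linarith
  have hr2 : r + 2 ≠ 0 := by linarith
  have hsub : Set.Icc b z ⊆ Set.Icc b X := Set.Icc_subset_Icc_right hzX
  have hsubo : Set.Ioo b z ⊆ Set.Ioo b X := Set.Ioo_subset_Ioo_right hzX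
  have cont : ∀ q : ℝ, 0 ≤ q → Continuous fun s : ℝ => (z - s) ^ q := fun q hq =>
    (continuous_const.sub continuous_id).rpow_const fun _ => Or.inr hq
  have hI1 : IntervalIntegrable (fun ξ => y1 ξ * (z - ξ) ^ r) MeasureTheory.volume b z := by
    have h0 : IntervalIntegrable (fun ξ : ℝ => (z - ξ) ^ r) MeasureTheory.volume b z := by
      have := (intervalIntegral.intervalIntegrable_rpow' (a := z - b) (b := 0) hr).comp_sub_left z
      simpa using this
    refine h0.continuousOn_mul ?_
    rw [Set.uIcc_of_le hbz.le]
    exact H.cont1.mono hsub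
  have hI3 : IntervalIntegrable (fun s => y3 s * (z - s) ^ (r + 2)) MeasureTheory.volume b z :=
    ContinuousOn.intervalIntegrable_of_Icc hbz.le
      ((H.cont3.mono hsub).mul (cont _ (by linarith)).continuousOn)
  have ftc := intervalIntegral.integral_eq_sub_of_hasDerivAt_of_le hbz.le
    (f := fun ξ => -(y1 ξ * ((z - ξ) ^ (r + 1) / (r + 1)))
      - y2 ξ * ((z - ξ) ^ (r + 2) / ((r + 1) * (r + 2))))
    (f' := fun ξ => y1 ξ * (z - ξ) ^ r - (y3 ξ * (z - ξ) ^ (r + 2)) / ((r + 1) * (r + 2)))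
    (((H.cont1.mono hsub).mul ((cont _ (by linarith)).continuousOn.div_const _)).neg.sub
      ((H.cont2.mono hsub).mul ((cont _ (by linarith)).continuousOn.div_const _)))
    (fun ξ hξ => by
      have hz : z - ξ ≠ 0 := by linarith [hξ.2]
      have e1 := ((hasDerivAt_id ξ).const_sub z).rpow_const (p := r + 1) (Or.inl hz)
      have e2 := ((hasDerivAt_id ξ).const_sub z).rpow_const (p := r + 2) (Or.inl hz)
      have := (((H.deriv2 ξ (hsubo hξ)).mul (e1.div_const (r + 1))).neg).sub
        ((H.deriv3 ξ (hsubo hξ)).mul (e2.div_const ((r + 1) * (r + 2))))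
      refine this.congr_deriv ?_
      simp only [id]
      rw [show r + 1 - 1 = r by ring, show r + 2 - 1 = r + 1 by ring]
      field_simp
      ring)
    (hI1.sub (hI3.div_const _))
  rw [intervalIntegral.integral_sub hI1 (hI3.div_const _), intervalIntegral.integral_div] at ftc
  simp only [sub_self, Real.zero_rpow hr1, Real.zero_rpow hr2] at ftc
  linear_combination ftc

lemma integral_deriv_eq (H : HasDerivsOn y y1 y2 y3 b X) {z : ℝ} (hbz : b ≤ z) (hzX : z ≤ X)
    (f : ℝ → ℝ) : ∫ ξ in b..z, deriv y ξ * f ξ = ∫ ξ in b..z, y1 ξ * f ξ := by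
  rw [intervalIntegral.integral_of_le hbz, intervalIntegral.integral_of_le hbz,
    MeasureTheory.integral_Ioc_eq_integral_Ioo, MeasureTheory.integral_Ioc_eq_integral_Ioo]
  refine MeasureTheory.setIntegral_congr_fun measurableSet_Ioo fun ξ hξ => ?_
  rw [(H.deriv1 ξ ⟨hξ.1, hξ.2.trans_le hzX⟩).deriv]

lemma caputo_eq (H : HasDerivsOn y y1 y2 y3 b X) {α z T : ℝ} (hα1 : α < 1)
    (hbz : b < z) (hzT : z ≤ T) (hTX : T ≤ X) :
    caputo α b y z = y1 b * (max (z - b) 0 ^ (1 - α) / Real.Gamma (2 - α))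
      + y2 b * (max (z - b) 0 ^ (2 - α) / Real.Gamma (3 - α))
      + (∫ s in b..T, y3 s * max (z - s) 0 ^ (2 - α)) / Real.Gamma (3 - α) := by
  have hβ : 0 < 1 - α := by linarith
  have hβ2 : 0 < 2 - α := by linarith
  have hG2 : Real.Gamma (2 - α) = (1 - α) * Real.Gamma (1 - α) := by
    rw [show 2 - α = 1 - α + 1 by ring, Real.Gamma_add_one hβ.ne']
  have hG3 : Real.Gamma (3 - α) = (2 - α) * ((1 - α) * Real.Gamma (1 - α)) := by
    rw [show 3 - α = 2 - α + 1 by ring, Real.Gamma_add_one hβ2.ne', hG2]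
  rw [caputo, H.integral_deriv_eq hbz.le (hzT.trans hTX),
    H.integral_mul_rpow_eq hbz (hzT.trans hTX) (by linarith), H.integral_max_eq hbz.le hzT hTX hβ2,
    max_eq_left (by linarith), hG2, hG3, show -α + 1 = 1 - α by ring, show -α + 2 = 2 - α by ring]
  field_simp

lemma taylor_eq (H : HasDerivsOn y y1 y2 y3 b X) (hyb : y b = 0) {t T : ℝ}
    (hbt : b ≤ t) (htT : t ≤ T) (hTX : T ≤ X) :
    y t = y1 b * max (t - b) 0 + y2 b * (max (t - b) 0 ^ 2 / 2)
      + (∫ s in b..T, y3 s * max (t - s) 0 ^ 2) / 2 := by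
  have h2 := H.integral_max_eq hbt htT hTX (r := 2) (by norm_num)
  simp only [Real.rpow_ofNat] at h2
  rw [h2, max_eq_left (by linarith)]
  rcases hbt.eq_or_lt with rfl | hbt
  · simp [hyb]
  have h1 := H.integral_mul_rpow_eq hbt (htT.trans hTX) (r := 0) (by norm_num)
  norm_num at h1
  have hsub : Set.Icc b t ⊆ Set.Icc b X := Set.Icc_subset_Icc_right (htT.trans hTX)
  have ftc := intervalIntegral.integral_eq_sub_of_hasDerivAt_of_le hbt.le (H.cont.mono hsub)
    (fun ξ hξ => H.deriv1 ξ ⟨hξ.1, hξ.2.trans_le (htT.trans hTX)⟩)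
    (ContinuousOn.intervalIntegrable_of_Icc hbt.le (H.cont1.mono hsub))
  rw [ftc, hyb, sub_zero] at h1
  exact h1

lemma abs_le_mul (H : HasDerivsOn y y1 y2 y3 b X) (hyb : y b = 0) {B t : ℝ}
    (hB : ∀ s ∈ Set.Icc b X, |y1 s| ≤ B) (hbt : b ≤ t) (htX : t ≤ X) :
    |y t| ≤ B * (t - b) := by
  have hsub : Set.Icc b t ⊆ Set.Icc b X := Set.Icc_subset_Icc_right htX
  have ftc := intervalIntegral.integral_eq_sub_of_hasDerivAt_of_le hbt (H.cont.mono hsub)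
    (fun ξ hξ => H.deriv1 ξ ⟨hξ.1, hξ.2.trans_le htX⟩)
    (ContinuousOn.intervalIntegrable_of_Icc hbt (H.cont1.mono hsub))
  have h := intervalIntegral.norm_integral_le_of_norm_le_const (a := b) (b := t) (f := y1) (C := B)
    (fun s hs => by
      rw [Set.uIoc_of_le hbt] at hs
      exact hB s ⟨hs.1.le, hs.2.trans htX⟩)
  rw [ftc, hyb, sub_zero, abs_of_nonneg (by linarith : 0 ≤ t - b)] at h
  exact h

end HasDerivsOn

lemma max_sub_sub_eq {h : ℝ} (hh : 0 < h) (T c s : ℝ) :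
    max (T - c * h - s) 0 = h * max ((T - s) / h - c) 0 := by
  rw [mul_max_of_nonneg _ _ hh.le, mul_zero]
  congr 1
  field_simp
  ring

namespace HasDerivsOn

variable {y y1 y2 y3 : ℝ → ℝ} {b X : ℝ}

/-- Peano representation of the error of the untruncated Grünwald sum. -/
lemma grunwald_error_eq (H : HasDerivsOn y y1 y2 y3 b X) (hyb : y b = 0) {α h T : ℝ}
    (hα0 : 0 < α) (hα1 : α < 1) (hh : 0 < h) (hbz : b < T - α / 2 * h) (hTX : T ≤ X) {N : ℕ}
    (hN : b ≤ T - N * h) :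
    h ^ (-α) * ∑ n ∈ Finset.range (N + 1), grunwaldW α n * y (T - n * h)
        - caputo α b y (T - α / 2 * h) =
      y1 b * (h ^ (1 - α) * (∑ n ∈ Finset.range (N + 1), grunwaldW α n * max ((T - b) / h - n) 0
        - max ((T - b) / h - α / 2) 0 ^ (1 - α) / Real.Gamma (2 - α)))
      + y2 b * (h ^ (2 - α) *
        (∑ n ∈ Finset.range (N + 1), grunwaldW α n * (max ((T - b) / h - n) 0 ^ 2 / 2)
        - max ((T - b) / h - α / 2) 0 ^ (2 - α) / Real.Gamma (3 - α)))
      + ∫ s in b..T, y3 s * (h ^ (2 - α) *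
        (∑ n ∈ Finset.range (N + 1), grunwaldW α n * (max ((T - s) / h - n) 0 ^ 2 / 2)
        - max ((T - s) / h - α / 2) 0 ^ (2 - α) / Real.Gamma (3 - α))) := by
  have hαh : 0 < α / 2 * h := by positivity
  have hp1 : h ^ (-α) * h = h ^ (1 - α) := by
    rw [← Real.rpow_add_one hh.ne']; congr 1; ring
  have hp2 : h ^ (-α) * h ^ 2 = h ^ (2 - α) := by
    rw [← Real.rpow_natCast, ← Real.rpow_add hh]; congr 1; push_cast; ring
  have hcap := H.caputo_eq hα1 hbz (by linarith) hTX
  have htay : ∀ n ∈ Finset.range (N + 1), grunwaldW α n * y (T - n * h) =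
      h * y1 b * (grunwaldW α n * max ((T - b) / h - n) 0)
      + h ^ 2 * y2 b * (grunwaldW α n * (max ((T - b) / h - n) 0 ^ 2 / 2))
      + ∫ s in b..T, grunwaldW α n / 2 * (y3 s * max (T - n * h - s) 0 ^ 2) := by
    intro n hn
    have hnN : (n : ℝ) * h ≤ N * h := by
      have : n ≤ N := by simpa [Nat.lt_succ_iff] using hn
      gcongr
    have hn0 : 0 ≤ (n : ℝ) * h := by positivity
    rw [H.taylor_eq hyb (by linarith : b ≤ T - n * h) (by linarith) hTX,
      intervalIntegral.integral_const_mul, max_sub_sub_eq hh]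
    ring
  have hI : ∀ n ∈ Finset.range (N + 1), IntervalIntegrable
      (fun s => grunwaldW α n / 2 * (y3 s * max (T - n * h - s) 0 ^ 2))
      MeasureTheory.volume b T := by
    intro n _
    have := H.intervalIntegrable_mul_max_rpow (by linarith) hTX (T - n * h) (r := 2) (by norm_num)
    simp only [Real.rpow_ofNat] at this
    exact this.const_mul _
  have hI' := (H.intervalIntegrable_mul_max_rpow (by linarith) hTX (T - α / 2 * h)
    (r := 2 - α) (by linarith)).div_const (Real.Gamma (3 - α))
  have hInt : ∫ s in b..T, y3 s * (h ^ (2 - α) *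
        (∑ n ∈ Finset.range (N + 1), grunwaldW α n * (max ((T - s) / h - n) 0 ^ 2 / 2)
        - max ((T - s) / h - α / 2) 0 ^ (2 - α) / Real.Gamma (3 - α))) =
      h ^ (-α) * (∑ n ∈ Finset.range (N + 1),
        ∫ s in b..T, grunwaldW α n / 2 * (y3 s * max (T - n * h - s) 0 ^ 2))
      - (∫ s in b..T, y3 s * max (T - α / 2 * h - s) 0 ^ (2 - α)) / Real.Gamma (3 - α) := by
    rw [← intervalIntegral.integral_finsetSum hI, ← intervalIntegral.integral_const_mul,
      ← intervalIntegral.integral_div, ← intervalIntegral.integral_sub _ hI']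
    · refine intervalIntegral.integral_congr fun s _ => ?_
      simp only [max_sub_sub_eq hh]
      rw [Real.mul_rpow hh.le (le_max_right _ _), mul_sub, mul_sub, Finset.mul_sum, Finset.mul_sum,
        Finset.mul_sum]
      congr 1
      · refine Finset.sum_congr rfl fun n _ => ?_
        rw [← hp2]
        ring
      · ring
    · refine IntervalIntegrable.const_mul ?_ _
      have := IntervalIntegrable.sum (Finset.range (N + 1)) hI
      refine this.congr ?_
      exact fun s _ => by simp [Finset.sum_apply]
  rw [hInt, hcap, Finset.sum_congr rfl htay, Finset.sum_add_distrib, Finset.sum_add_distrib,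
    ← Finset.mul_sum, ← Finset.mul_sum,
    max_sub_sub_eq hh,
    Real.mul_rpow hh.le (le_max_right _ _), Real.mul_rpow hh.le (le_max_right _ _), ← hp1, ← hp2]
  ring

lemma abs_grunwald_error_le (H : HasDerivsOn y y1 y2 y3 b X) (hyb : y b = 0) {α h T L B : ℝ}
    (hα0 : 0 < α) (hα1 : α < 1) (hh : 0 < h) (hhL : h ≤ L) (hLT : L ≤ T - b) (hTX : T ≤ X)
    (hB : ∀ s ∈ Set.Icc b X, |y3 s| ≤ B) :
    |h ^ (-α) * ∑ n ∈ Finset.range (⌊(T - b) / h⌋₊ + 1), grunwaldW α n * y (T - n * h)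
        - caputo α b y (T - α / 2 * h)| ≤
      (|y1 b| * (36 / Real.Gamma (2 - α) * L ^ (-(1 + α)))
        + |y2 b| * ((1 + 40 / Real.Gamma (3 - α)) * L ^ (-α))
        + B * ((1 + 40 / Real.Gamma (3 - α)) * ((X - b) ^ (1 - α) / (1 - α)))) * h ^ 2 := by
  have hG2 := Real.Gamma_pos_of_pos (by linarith : 0 < 2 - α)
  have hG3 := Real.Gamma_pos_of_pos (by linarith : 0 < 3 - α)
  have hβ : 0 < 1 - α := by linarith
  have hL : 0 < L := by linarith
  have hbT : b ≤ T := by linarith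
  have hU : 1 ≤ (T - b) / h := by rw [one_le_div hh]; linarith
  have hB0 : 0 ≤ B := (abs_nonneg _).trans (hB b ⟨le_rfl, by linarith⟩)
  have hfl := Nat.floor_le (by linarith : 0 ≤ (T - b) / h)
  rw [H.grunwald_error_eq hyb hα0 hα1 hh (by nlinarith) hTX
    (by rw [le_div_iff₀ hh] at hfl; linarith)]
  have hscale : ∀ r q : ℝ, q - r = 2 → ∀ v, 0 < v → h ^ q * (v / h) ^ r = v ^ r * h ^ 2 := by
    intro r q hqr v hv
    rw [Real.div_rpow hv.le hh.le, ← Real.rpow_natCast h 2, show ((2 : ℕ) : ℝ) = q - r by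
      rw [hqr]; norm_num, Real.rpow_sub hh]
    ring
  have t1 : |y1 b * (h ^ (1 - α) * (∑ n ∈ Finset.range (⌊(T - b) / h⌋₊ + 1),
      grunwaldW α n * max ((T - b) / h - n) 0
      - max ((T - b) / h - α / 2) 0 ^ (1 - α) / Real.Gamma (2 - α)))| ≤
      |y1 b| * (36 / Real.Gamma (2 - α) * L ^ (-(1 + α))) * h ^ 2 := by
    rw [abs_mul, abs_mul, abs_of_pos (by positivity : 0 < h ^ (1 - α)), mul_assoc |_|]
    refine mul_le_mul_of_nonneg_left ?_ (abs_nonneg _)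
    calc _ ≤ h ^ (1 - α) * (36 / Real.Gamma (2 - α) * ((T - b) / h) ^ (-(1 + α))) := by
          gcongr
          exact abs_sum_grunwaldW_mul_max_sub_le hα0 hα1 hU le_rfl
      _ = 36 / Real.Gamma (2 - α) * (T - b) ^ (-(1 + α)) * h ^ 2 := by
        rw [mul_assoc, ← hscale (-(1 + α)) (1 - α) (by ring) (T - b) (by linarith)]
        ring
      _ ≤ _ := by
        have := Real.rpow_le_rpow_of_nonpos hL hLT (by linarith : -(1 + α) ≤ 0)
        gcongr
  have t2 : |y2 b * (h ^ (2 - α) * (∑ n ∈ Finset.range (⌊(T - b) / h⌋₊ + 1),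
      grunwaldW α n * (max ((T - b) / h - n) 0 ^ 2 / 2)
      - max ((T - b) / h - α / 2) 0 ^ (2 - α) / Real.Gamma (3 - α)))| ≤
      |y2 b| * ((1 + 40 / Real.Gamma (3 - α)) * L ^ (-α)) * h ^ 2 := by
    rw [abs_mul, abs_mul, abs_of_pos (by positivity : 0 < h ^ (2 - α)), mul_assoc |_|]
    refine mul_le_mul_of_nonneg_left ?_ (abs_nonneg _)
    calc _ ≤ h ^ (2 - α) * ((1 + 40 / Real.Gamma (3 - α)) * ((T - b) / h) ^ (-α)) := by
          gcongr
          exact abs_sum_grunwaldW_mul_max_sq_sub_le hα0 hα1 (by linarith) le_rfl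
      _ = (1 + 40 / Real.Gamma (3 - α)) * (T - b) ^ (-α) * h ^ 2 := by
        rw [mul_assoc, ← hscale (-α) (2 - α) (by ring) (T - b) (by linarith)]
        ring
      _ ≤ _ := by
        have := Real.rpow_le_rpow_of_nonpos hL hLT (by linarith : -α ≤ 0)
        gcongr
  have t3 : |∫ s in b..T, y3 s * (h ^ (2 - α) * (∑ n ∈ Finset.range (⌊(T - b) / h⌋₊ + 1),
      grunwaldW α n * (max ((T - s) / h - n) 0 ^ 2 / 2)
      - max ((T - s) / h - α / 2) 0 ^ (2 - α) / Real.Gamma (3 - α)))| ≤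
      B * ((1 + 40 / Real.Gamma (3 - α)) * ((X - b) ^ (1 - α) / (1 - α))) * h ^ 2 := by
    have hint : IntervalIntegrable (fun s : ℝ => (T - s) ^ (-α)) MeasureTheory.volume b T := by
      have := (intervalIntegral.intervalIntegrable_rpow' (a := T - b) (b := 0)
        (by linarith : -1 < -α)).comp_sub_left T
      simpa using this
    have hval : ∫ s in b..T, (T - s) ^ (-α) = (T - b) ^ (1 - α) / (1 - α) := by
      rw [intervalIntegral.integral_comp_sub_left (fun s => s ^ (-α)) T, sub_self,
        integral_rpow (Or.inl (by linarith)), show -α + 1 = 1 - α by ring,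
        Real.zero_rpow hβ.ne', sub_zero]
    have hbound := intervalIntegral.norm_integral_le_of_norm_le (μ := MeasureTheory.volume)
      (f := fun s => y3 s * (h ^ (2 - α) * (∑ n ∈ Finset.range (⌊(T - b) / h⌋₊ + 1),
        grunwaldW α n * (max ((T - s) / h - n) 0 ^ 2 / 2)
        - max ((T - s) / h - α / 2) 0 ^ (2 - α) / Real.Gamma (3 - α))))
      (g := fun s => B * (1 + 40 / Real.Gamma (3 - α)) * h ^ 2 * (T - s) ^ (-α)) hbT ?_
      (hint.const_mul _)
    · rw [intervalIntegral.integral_const_mul, hval] at hbound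
      refine hbound.trans ?_
      calc _ ≤ B * (1 + 40 / Real.Gamma (3 - α)) * h ^ 2 * ((X - b) ^ (1 - α) / (1 - α)) := by
            gcongr
        _ = _ := by ring
    · have hne : ∀ᵐ s : ℝ, s ≠ T := by
        simp [MeasureTheory.ae_iff]
      filter_upwards [hne] with s hsT hs
      have hsT' : 0 < T - s := by
        have := lt_of_le_of_ne hs.2 hsT
        linarith
      rw [Real.norm_eq_abs, abs_mul, abs_mul, abs_of_pos (by positivity : 0 < h ^ (2 - α))]
      have hfl2 : ⌊(T - s) / h⌋₊ ≤ ⌊(T - b) / h⌋₊ := by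
        gcongr
        exact hs.1.le
      calc _ ≤ B * (h ^ (2 - α) * ((1 + 40 / Real.Gamma (3 - α)) * ((T - s) / h) ^ (-α))) := by
            gcongr
            · exact hB s ⟨hs.1.le, hs.2.trans hTX⟩
            · exact abs_sum_grunwaldW_mul_max_sq_sub_le hα0 hα1 (by positivity) hfl2
        _ = B * (1 + 40 / Real.Gamma (3 - α)) * (h ^ (2 - α) * ((T - s) / h) ^ (-α)) := by ring
        _ = _ := by
          rw [hscale (-α) (2 - α) (by ring) (T - s) hsT']
          ring
  rw [add_mul, add_mul]
  exact (abs_add_le _ _).trans (add_le_add ((abs_add_le _ _).trans (add_le_add t1 t2)) t3)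

/-- The terms lost by truncating the shifted sum at `⌊(x - b) / h⌋` are of second order. -/
lemma abs_grunwald_tail_le (H : HasDerivsOn y y1 y2 y3 b X) (hyb : y b = 0) {α p h x B : ℝ}
    (hα0 : 0 < α) (hα1 : α < 1) (hp : 0 ≤ p) (hh : 0 < h) (hhx : h ≤ x - b) (hX : x + p * h ≤ X)
    (hB : ∀ s ∈ Set.Icc b X, |y1 s| ≤ B) :
    |h ^ (-α) * ∑ n ∈ Finset.Ico (⌊(x - b) / h⌋₊ + 1) (⌊(x + p * h - b) / h⌋₊ + 1),
        grunwaldW α n * y (x + p * h - n * h)| ≤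
      (p + 1) * (3 / Real.Gamma (2 - α) * (x - b) ^ (-(1 + α)) * (B * p)) * h ^ 2 := by
  have hG2 := Real.Gamma_pos_of_pos (by linarith : 0 < 2 - α)
  have hL : 0 < x - b := by linarith
  have hph : 0 ≤ p * h := by positivity
  have hB0 : 0 ≤ B := (abs_nonneg _).trans (hB b ⟨le_rfl, by linarith⟩)
  have hsplit : (x + p * h - b) / h = (x - b) / h + p := by field_simp; ring
  have hterm : ∀ n ∈ Finset.Ico (⌊(x - b) / h⌋₊ + 1) (⌊(x + p * h - b) / h⌋₊ + 1),
      |grunwaldW α n * y (x + p * h - n * h)| ≤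
        3 / Real.Gamma (2 - α) * ((x - b) / h) ^ (-(1 + α)) * (B * (p * h)) := by
    intro n hn
    rw [Finset.mem_Ico] at hn
    have hn1 : (x - b) / h < n := Nat.lt_of_floor_lt (by omega)
    have hn2 : (n : ℝ) ≤ (x + p * h - b) / h :=
      (Nat.le_floor_iff (by rw [hsplit]; positivity)).1 (by omega)
    rw [le_div_iff₀ hh] at hn2
    have hn3 := hn1
    rw [div_lt_iff₀ hh] at hn3
    have hw := abs_grunwaldW_le hα0 hα1 (by omega : 1 ≤ n)
    have hmono := Real.rpow_le_rpow_of_nonpos (by positivity) hn1.le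
      (by linarith : -(1 + α) ≤ 0)
    have hyt := H.abs_le_mul hyb hB (by linarith : b ≤ x + p * h - n * h)
      (by have : 0 ≤ (n : ℝ) * h := by positivity
          linarith)
    rw [abs_mul]
    refine mul_le_mul (hw.trans (by gcongr)) (hyt.trans ?_) (abs_nonneg _) (by positivity)
    gcongr
    linarith
  have hcard : ((Finset.Ico (⌊(x - b) / h⌋₊ + 1) (⌊(x + p * h - b) / h⌋₊ + 1)).card : ℝ)
      ≤ p + 1 := by
    have hle : ⌊(x - b) / h⌋₊ ≤ ⌊(x + p * h - b) / h⌋₊ := by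
      gcongr
      linarith
    rw [Nat.card_Ico, Nat.add_sub_add_right, Nat.cast_sub hle]
    have h1 := Nat.lt_floor_add_one ((x - b) / h)
    have h2 := Nat.floor_le (by rw [hsplit]; positivity : 0 ≤ (x + p * h - b) / h)
    linarith
  have hscale : h ^ (-α) * (((x - b) / h) ^ (-(1 + α)) * h) = (x - b) ^ (-(1 + α)) * h ^ 2 := by
    rw [Real.div_rpow hL.le hh.le, Real.rpow_neg hh.le (1 + α), Real.rpow_neg hh.le,
      Real.rpow_add hh, Real.rpow_one]
    field_simp
  rw [abs_mul, abs_of_pos (by positivity : 0 < h ^ (-α))]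
  calc _ ≤ h ^ (-α) * ((p + 1) *
        (3 / Real.Gamma (2 - α) * ((x - b) / h) ^ (-(1 + α)) * (B * (p * h)))) := by
        gcongr
        refine (Finset.abs_sum_le_sum_abs _ _).trans ((Finset.sum_le_card_nsmul _ _ _ hterm).trans ?_)
        rw [nsmul_eq_mul]
        gcongr
    _ = (p + 1) * (3 / Real.Gamma (2 - α) * (B * p)) *
        (h ^ (-α) * (((x - b) / h) ^ (-(1 + α)) * h)) := by ring
    _ = _ := by
      rw [hscale]
      ring

end HasDerivsOn

/-- second order approximation of the Caputo derivative by the shifted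
Grünwald formula at the shifted point `x + (p - α/2) h`. -/
theorem shiftedGrunwald_second_order
    (α p b X : ℝ) (y : ℝ → ℝ)
    (hα0 : 0 < α) (hα1 : α < 1) (hp : 0 ≤ p)
    (hy : ContDiffOn ℝ 4 y (Set.Icc b X))
    (hext : ∀ t, t < b → y t = 0)
    (hyb : y b = 0) (hyb1 : deriv y b = 0) (hyb2 : deriv (deriv y) b = 0) :
    ∀ x, b < x → x < X →
      ∃ C > 0, ∃ h₀ > 0, ∀ h : ℝ, 0 < h → h < h₀ → x + p * h ≤ X →
        |h ^ (-α) * shiftedGrunwald α b p h y x -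
            caputo α b y (x + (p - α / 2) * h)| ≤ C * h ^ 2 := by
  intro x hbx hxX
  obtain ⟨y1, y2, y3, H⟩ := exists_hasDerivsOn (hbx.trans hxX) (hy.of_le (by norm_num))
  obtain ⟨B1, hB1⟩ := isCompact_Icc.exists_bound_of_continuousOn H.cont1
  obtain ⟨B3, hB3⟩ := isCompact_Icc.exists_bound_of_continuousOn H.cont3
  set C1 := |y1 b| * (36 / Real.Gamma (2 - α) * (x - b) ^ (-(1 + α)))
        + |y2 b| * ((1 + 40 / Real.Gamma (3 - α)) * (x - b) ^ (-α))
        + B3 * ((1 + 40 / Real.Gamma (3 - α)) * ((X - b) ^ (1 - α) / (1 - α))) with hC1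
  set C2 := (p + 1) * (3 / Real.Gamma (2 - α) * (x - b) ^ (-(1 + α)) * (B1 * p)) with hC2
  refine ⟨|C1 + C2| + 1, by positivity, x - b, by linarith, fun h hh hhx hX => ?_⟩
  have hph : 0 ≤ p * h := by positivity
  have e1 := H.abs_grunwald_error_le hyb hα0 hα1 hh hhx.le
    (by linarith : x - b ≤ x + p * h - b) hX hB3
  have e2 := H.abs_grunwald_tail_le hyb hα0 hα1 hp hh hhx.le hX hB1
  rw [← hC1] at e1
  rw [← hC2] at e2
  have hle : ⌊(x - b) / h⌋₊ + 1 ≤ ⌊(x + p * h - b) / h⌋₊ + 1 := by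
    gcongr
    linarith
  have hsum : shiftedGrunwald α b p h y x =
      ∑ n ∈ Finset.range (⌊(x + p * h - b) / h⌋₊ + 1), grunwaldW α n * y (x + p * h - n * h)
      - ∑ n ∈ Finset.Ico (⌊(x - b) / h⌋₊ + 1) (⌊(x + p * h - b) / h⌋₊ + 1),
        grunwaldW α n * y (x + p * h - n * h) := by
    rw [eq_sub_iff_add_eq, ← Finset.sum_range_add_sum_Ico _ hle]
    congr 1
    refine Finset.sum_congr rfl fun n _ => ?_
    congr 2
    ring
  rw [hsum, show x + (p - α / 2) * h = x + p * h - α / 2 * h by ring, mul_sub, sub_right_comm]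
  calc _ ≤ C1 * h ^ 2 + C2 * h ^ 2 := (abs_sub _ _).trans (add_le_add e1 e2)
    _ = (C1 + C2) * h ^ 2 := by ring
    _ ≤ (|C1 + C2| + 1) * h ^ 2 :=
      mul_le_mul_of_nonneg_right (by linarith [le_abs_self (C1 + C2)]) (by positivity)
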